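/- arXiv:0806.2712 — 2 statements merged into one kernel-verified Lean document; each statement's English description precedes it below -/
import Mathlib

section
/- Let U be an open subset of ℝ^p and let f : U → ℝ^q be of class C^s with s a natural number satisfying s > max(p − q, 0). Then the set of critical values of f, i.e. the set of points y ∈ ℝ^q for which there exists x ∈ U with f(x) = y and the Fréchet derivative Df(x) : ℝ^p → ℝ^q not surjective, has Lebesgue measure zero in ℝ^q. -/
open MeasureTheory Set Topology

namespace SardAux

open Filter Asymptotics
open scoped ENNReal NNReal

lemma null_image {n m s : ℕ} (hs : 1 ≤ s) (hm : 1 ≤ m) (hnm : n ≤ s * m)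
    (h : (Fin n → ℝ) → (Fin m → ℝ)) (B : Set (Fin n → ℝ))
    (hB : ∀ x ∈ B, (fun y => h y - h x) =o[𝓝 x] fun y => ‖y - x‖ ^ s) :
    volume (h '' B) = 0 := by
  have key : ∀ (R : ℕ) (ε : ℝ≥0), 0 < ε → ε ≤ 1 →
      volume (h '' (B ∩ Metric.ball 0 R)) ≤ ε * volume (Metric.ball (0 : Fin n → ℝ) R) := by
    intro R ε hε hε1
    let BN : ℕ → Set (Fin n → ℝ) := fun N =>
      {x ∈ B ∩ Metric.ball 0 R | ∀ y, dist y x < 1 / ((N : ℝ) + 1) →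
        ‖h y - h x‖ ≤ ε * ‖y - x‖ ^ s}
    have hmono : Monotone BN := by
      intro N M hNM x hx
      refine ⟨hx.1, fun y hy => hx.2 y (hy.trans_le ?_)⟩
      exact one_div_le_one_div_of_le (by positivity) (by gcongr)
    have hcov : B ∩ Metric.ball 0 R ⊆ ⋃ N, BN N := by
      intro x hx
      have h1 := (isLittleO_iff.1 (hB x hx.1)) (c := (ε : ℝ)) (by exact_mod_cast hε)
      obtain ⟨δ, hδ, h2⟩ := Metric.eventually_nhds_iff.1 h1
      obtain ⟨N, hN⟩ := exists_nat_one_div_lt hδ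
      refine mem_iUnion.2 ⟨N, hx, fun y hy => ?_⟩
      have := h2 (hy.trans hN)
      simpa using this
    have hbound : ∀ N, volume (h '' BN N) ≤ ε * volume (Metric.ball (0 : Fin n → ℝ) R) := by
      intro N
      set δ : ℝ := 1 / ((N : ℝ) + 1) with hδ
      have hδ0 : 0 < δ := by positivity
      let D : ℕ → Set (Fin n → ℝ) :=
        disjointed (fun j => Metric.ball (TopologicalSpace.denseSeq (Fin n → ℝ) j) (δ / 2))
      have hDm : ∀ j, MeasurableSet (D j) := fun j =>
        MeasurableSet.disjointed (fun j => Metric.isOpen_ball.measurableSet) j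
      have hDd : Pairwise (Function.onFun Disjoint D) := disjoint_disjointed _
      have hDU : ⋃ j, D j = univ := by
        rw [iUnion_disjointed, eq_univ_iff_forall]
        intro x
        obtain ⟨j, hj⟩ := (TopologicalSpace.denseRange_denseSeq (Fin n → ℝ)).exists_dist_lt x
          (half_pos hδ0)
        exact mem_iUnion.2 ⟨j, hj⟩
      have hhol : ∀ j, HolderOnWith ε (s : ℝ≥0) h (BN N ∩ D j) := by
        intro j x hx y hy
        have hxj := disjointed_subset _ j hx.2
        have hyj := disjointed_subset _ j hy.2
        have hd : dist y x < δ := by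
          have := dist_triangle_right y x (TopologicalSpace.denseSeq (Fin n → ℝ) j)
          simp only [Metric.mem_ball] at hxj hyj
          linarith
        have := hx.1.2 y hd
        rw [edist_comm, edist_comm x y, edist_eq_enorm_sub, edist_eq_enorm_sub]
        simp only [NNReal.coe_natCast, ENNReal.rpow_natCast]
        have h2 : ‖h y - h x‖₊ ≤ ε * ‖y - x‖₊ ^ s := by
          rw [← NNReal.coe_le_coe]; push_cast; exact this
        simp only [enorm]
        exact_mod_cast h2
      have hVm : (μH[(m : ℝ)] : Measure (Fin m → ℝ)) = volume := by
        simpa using hausdorffMeasure_pi_real (ι := Fin m)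
      have hVn : (μH[(n : ℝ)] : Measure (Fin n → ℝ)) = volume := by
        simpa using hausdorffMeasure_pi_real (ι := Fin n)
      calc volume (h '' BN N) ≤ volume (⋃ j, h '' (BN N ∩ D j)) := by
            apply measure_mono
            rw [← image_iUnion, ← inter_iUnion, hDU, inter_univ]
        _ ≤ ∑' j, volume (h '' (BN N ∩ D j)) := measure_iUnion_le _
        _ ≤ ∑' j, (ε : ℝ≥0∞) * volume (Metric.ball (0 : Fin n → ℝ) R ∩ D j) := by
            refine ENNReal.tsum_le_tsum fun j => ?_
            rw [← hVm, ← hVn]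
            refine ((hhol j).hausdorffMeasure_image_le (by exact_mod_cast hs)
              (Nat.cast_nonneg m)).trans ?_
            refine mul_le_mul' ?_ ?_
            · rw [ENNReal.rpow_natCast]
              exact pow_le_of_le_one (by simp) (by exact_mod_cast hε1) (by omega)
            · refine (Measure.hausdorffMeasure_mono (d₁ := n) ?_ _).trans (measure_mono ?_)
              · simp only [NNReal.coe_natCast]; exact_mod_cast hnm
              · exact inter_subset_inter_left _ fun x hx => hx.1.2
        _ = ε * volume (Metric.ball (0 : Fin n → ℝ) R) := by
            rw [ENNReal.tsum_mul_left, ← measure_iUnion, ← inter_iUnion, hDU, inter_univ]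
            · intro i j hij
              exact (hDd hij).mono inter_subset_right inter_subset_right
            · exact fun j => Metric.isOpen_ball.measurableSet.inter (hDm j)
    calc volume (h '' (B ∩ Metric.ball 0 R)) ≤ volume (⋃ N, h '' BN N) := by
          apply measure_mono; rw [← image_iUnion]; exact image_mono hcov
      _ = ⨆ N, volume (h '' BN N) := by
          apply Monotone.measure_iUnion
          exact fun i j hij => image_mono (hmono hij)
      _ ≤ _ := iSup_le hbound
  have key2 : ∀ R : ℕ, volume (h '' (B ∩ Metric.ball 0 R)) = 0 := by
    intro R
    refine le_antisymm ?_ zero_le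
    have hfin : volume (Metric.ball (0 : Fin n → ℝ) R) ≠ ∞ := Metric.isBounded_ball.measure_lt_top.ne
    refine ENNReal.le_of_forall_pos_le_add fun ε hε _ => ?_
    set V := (volume (Metric.ball (0 : Fin n → ℝ) R)).toNNReal with hV
    have hV' : volume (Metric.ball (0 : Fin n → ℝ) R) = V := (ENNReal.coe_toNNReal hfin).symm
    have := key R (min 1 (ε / (V + 1))) (by positivity) (min_le_left _ _)
    rw [hV'] at this
    refine this.trans ?_
    rw [zero_add]
    norm_cast
    calc min 1 (ε / (V + 1)) * V ≤ (ε / (V + 1)) * (V + 1) := by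
          gcongr
          · exact min_le_right _ _
          · exact le_self_add
      _ = ε := by field_simp
  have : h '' B ⊆ ⋃ R : ℕ, h '' (B ∩ Metric.ball 0 R) := by
    rw [← image_iUnion, ← inter_iUnion, Metric.iUnion_ball_nat, inter_univ]
  exact measure_mono_null this (measure_iUnion_null key2)

lemma straighten {p r d s : ℕ} (hs : 1 ≤ s) (hp : p = r + d) (x0 : Fin p → ℝ)
    (F : (Fin p → ℝ) → (Fin r → ℝ)) (hF : ContDiffAt ℝ s F x0)
    (hsurj : Function.Surjective (fderiv ℝ F x0)) (U : Set (Fin p → ℝ)) (hU : U ∈ 𝓝 x0) :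
    ∃ V ∈ 𝓝 x0, ∃ W : Set ((Fin r → ℝ) × (Fin d → ℝ)), IsOpen W ∧
      ∃ (Ψ : (Fin r → ℝ) × (Fin d → ℝ) → (Fin p → ℝ)) (φ : (Fin p → ℝ) → (Fin d → ℝ)),
        (∀ w ∈ W, ContDiffAt ℝ s Ψ w ∧ Ψ w ∈ U ∧ F (Ψ w) = w.1) ∧
        ∀ x ∈ V, (F x, φ x) ∈ W ∧ Ψ (F x, φ x) = x := by
  set T := fderiv ℝ F x0 with hT
  have hs0 : (s : WithTop ℕ∞) ≠ 0 := by exact_mod_cast (by omega : s ≠ 0)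
  let K := LinearMap.ker (T : (Fin p → ℝ) →ₗ[ℝ] (Fin r → ℝ))
  have hK : Module.finrank ℝ K = Module.finrank ℝ (Fin d → ℝ) := by
    have h1 := LinearMap.finrank_range_add_finrank_ker (T : (Fin p → ℝ) →ₗ[ℝ] (Fin r → ℝ))
    have h2 : LinearMap.range (T : (Fin p → ℝ) →ₗ[ℝ] (Fin r → ℝ)) = ⊤ :=
      LinearMap.range_eq_top.2 hsurj
    rw [h2, finrank_top] at h1
    simp only [Module.finrank_fin_fun] at h1 ⊢
    change r + Module.finrank ℝ K = p at h1
    omega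
  let eK : K ≃ₗ[ℝ] (Fin d → ℝ) := LinearEquiv.ofFinrankEq _ _ hK
  obtain ⟨P, hP⟩ := LinearMap.exists_leftInverse_of_injective K.subtype (by simp)
  let π : (Fin p → ℝ) →L[ℝ] (Fin d → ℝ) := LinearMap.toContinuousLinearMap (eK.toLinearMap ∘ₗ P)
  let L : (Fin p → ℝ) →L[ℝ] (Fin r → ℝ) × (Fin d → ℝ) := T.prod π
  have hL : Function.Injective (L : (Fin p → ℝ) →ₗ[ℝ] (Fin r → ℝ) × (Fin d → ℝ)) := by
    rw [injective_iff_map_eq_zero]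
    intro v hv
    have hv' : (T v, π v) = 0 := hv
    rw [Prod.mk_eq_zero] at hv'
    have h1 : v ∈ K := hv'.1
    have h2 : eK (P v) = 0 := hv'.2
    have h3 : P v = ⟨v, h1⟩ := LinearMap.congr_fun hP ⟨v, h1⟩
    rw [h3] at h2
    simpa using h2
  let e : (Fin p → ℝ) ≃L[ℝ] (Fin r → ℝ) × (Fin d → ℝ) :=
    (LinearMap.linearEquivOfInjective _ hL (by simp [hp])).toContinuousLinearEquiv
  have he : (e : (Fin p → ℝ) →L[ℝ] (Fin r → ℝ) × (Fin d → ℝ)) = L := by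
    ext v <;> rfl
  let Φ : (Fin p → ℝ) → (Fin r → ℝ) × (Fin d → ℝ) := fun x => (F x, π x)
  have hΦ : ContDiffAt ℝ s Φ x0 := hF.prodMk π.contDiff.contDiffAt
  have hΦ' : HasFDerivAt Φ (e : (Fin p → ℝ) →L[ℝ] (Fin r → ℝ) × (Fin d → ℝ)) x0 := by
    rw [he]
    exact (hF.differentiableAt hs0).hasFDerivAt.prodMk π.hasFDerivAt
  let H := hΦ.toOpenPartialHomeomorph Φ hΦ' hs0
  have hx0 : x0 ∈ H.source := hΦ.mem_toOpenPartialHomeomorph_source hΦ' hs0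
  have hHx0 : H x0 ∈ H.target := H.map_source hx0
  have hsymm : ContDiffAt ℝ s H.symm (H x0) := hΦ.to_localInverse hΦ' hs0
  have hH : ∀ x, H x = (F x, π x) := fun x => rfl
  have ev1 : ∀ᶠ w in 𝓝 (H x0), ContDiffAt ℝ s H.symm w :=
    hsymm.eventually (by simp)
  have ev2 : ∀ᶠ w in 𝓝 (H x0), H.symm w ∈ U := by
    have := hsymm.continuousAt
    apply this
    rwa [H.left_inv hx0]
  have ev3 : ∀ᶠ w in 𝓝 (H x0), w ∈ H.target := H.open_target.mem_nhds hHx0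
  obtain ⟨W, hW, hWo, hW0⟩ := eventually_nhds_iff.1 (ev1.and (ev2.and ev3))
  refine ⟨H.source ∩ H ⁻¹' W, ?_, W, hWo, H.symm, π, ?_, ?_⟩
  · exact (H.continuousOn.isOpen_inter_preimage H.open_source hWo).mem_nhds ⟨hx0, hW0⟩
  · intro w hw
    obtain ⟨h1, h2, h3⟩ := hW w hw
    refine ⟨h1, h2, ?_⟩
    have := H.right_inv h3
    rw [hH] at this
    exact congrArg Prod.fst this
  · intro x hx
    exact ⟨hx.2, H.left_inv hx.1⟩

def Good {n : ℕ} (k : ℕ) (A : Set (Fin n → ℝ)) {F : Type} [NormedAddCommGroup F]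
    [NormedSpace ℝ F] (g : (Fin n → ℝ) → F) : Prop :=
  ∀ x ∈ A, ContDiffAt ℝ k g x ∧ g x = 0

def Piece {n : ℕ} (k : ℕ) (A S : Set (Fin n → ℝ)) : Prop :=
  ∃ m ≤ n, ∃ (ψ : (Fin m → ℝ) → (Fin n → ℝ)) (B : Set (Fin m → ℝ)),
    S ⊆ ψ '' B ∧ MapsTo ψ B A ∧ (∀ x ∈ B, ContDiffAt ℝ 1 ψ x) ∧
    ∀ (F : Type) [NormedAddCommGroup F] [NormedSpace ℝ F] (g : (Fin n → ℝ) → F),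
      Good k A g → ∀ x ∈ B, (fun y => g (ψ y)) =o[𝓝 x] fun y => ‖y - x‖ ^ k

def Dec {n : ℕ} (k : ℕ) (A C : Set (Fin n → ℝ)) : Prop :=
  ∃ T : Set (Set (Fin n → ℝ)), T.Countable ∧ C ⊆ ⋃₀ T ∧ ∀ S ∈ T, Piece k A S

lemma Piece.mono {n k : ℕ} {A A' S : Set (Fin n → ℝ)} (h : A' ⊆ A) (hS : Piece k A' S) :
    Piece k A S := by
  obtain ⟨m, hm, ψ, B, h1, h2, h3, h4⟩ := hS
  exact ⟨m, hm, ψ, B, h1, h2.mono_right h, h3, fun F _ _ g hg => h4 F g fun x hx => hg x (h hx)⟩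

lemma Dec.biUnion {n k : ℕ} {A C : Set (Fin n → ℝ)} {ι : Type*} {t : Set ι} (ht : t.Countable)
    (V : ι → Set (Fin n → ℝ)) (hC : C ⊆ ⋃ i ∈ t, V i) (h : ∀ i ∈ t, Dec k A (V i)) :
    Dec k A C := by
  choose! T h1 h2 h3 using h
  refine ⟨⋃ i ∈ t, T i, ht.biUnion h1, ?_, ?_⟩
  · intro x hx
    obtain ⟨i, hi, hxi⟩ := mem_iUnion₂.1 (hC hx)
    obtain ⟨S, hS, hxS⟩ := h2 i hi hxi
    exact ⟨S, mem_biUnion hi hS, hxS⟩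
  · intro S hS
    obtain ⟨i, hi, hSi⟩ := mem_iUnion₂.1 hS
    exact h3 i hi S hSi

lemma Dec.union {n k : ℕ} {A C D : Set (Fin n → ℝ)} (hC : Dec k A C) (hD : Dec k A D) :
    Dec k A (C ∪ D) := by
  obtain ⟨T, h1, h2, h3⟩ := hC
  obtain ⟨T', h1', h2', h3'⟩ := hD
  refine ⟨T ∪ T', h1.union h1', ?_, ?_⟩
  · rw [sUnion_union]; exact union_subset_union h2 h2'
  · rintro S (hS | hS)
    exacts [h3 S hS, h3' S hS]

/-- Integrating the little-o estimate for the derivative. -/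
lemma littleO_step {m n k : ℕ} {F : Type} [NormedAddCommGroup F] [NormedSpace ℝ F]
    {g : (Fin n → ℝ) → F} {ψ : (Fin m → ℝ) → (Fin n → ℝ)} {x : Fin m → ℝ}
    (hg : ContDiffAt ℝ 1 g (ψ x)) (hψ : ContDiffAt ℝ 1 ψ x)
    (ho : (fun y => fderiv ℝ g (ψ y)) =o[𝓝 x] fun y => ‖y - x‖ ^ k) :
    (fun y => g (ψ y) - g (ψ x)) =o[𝓝 x] fun y => ‖y - x‖ ^ (k + 1) := by
  have e1 : ∀ᶠ y in 𝓝 x, ContDiffAt ℝ 1 ψ y := hψ.eventually (by simp)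
  have e2 : ∀ᶠ y in 𝓝 x, ContDiffAt ℝ 1 g (ψ y) :=
    hψ.continuousAt.eventually (hg.eventually (by simp))
  obtain ⟨δ, hδ, hball⟩ := Metric.eventually_nhds_iff_ball.1 (e1.and e2)
  have hx : x ∈ Metric.ball x δ := Metric.mem_ball_self hδ
  have hnh : 𝓝[Metric.ball x δ] x = 𝓝 x := Metric.isOpen_ball.nhdsWithin_eq hx
  have := (convex_ball x δ).isLittleO_pow_succ (f := fun y => g (ψ y))
    (f' := fun y => (fderiv ℝ g (ψ y)).comp (fderiv ℝ ψ y)) (n := k) hx ?_ ?_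
  · rwa [hnh] at this
  · intro y hy
    obtain ⟨h1, h2⟩ := hball y hy
    exact ((h2.differentiableAt (by simp)).hasFDerivAt.comp y
      (h1.differentiableAt (by simp)).hasFDerivAt).hasFDerivWithinAt
  · rw [hnh]
    have hb : (fun y => fderiv ℝ ψ y) =O[𝓝 x] fun _ => (1 : ℝ) := by
      have : ContinuousAt (fderiv ℝ ψ) x :=
        (hψ.fderiv_right (m := 0) (by simp)).continuousAt
      exact this.isBigO_one ℝ
    have h1 : (fun y => (fderiv ℝ g (ψ y)).comp (fderiv ℝ ψ y)) =O[𝓝 x]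
        fun y => ‖fderiv ℝ g (ψ y)‖ * ‖fderiv ℝ ψ y‖ :=
      IsBigO.of_norm_le fun y => ContinuousLinearMap.opNorm_comp_le _ _
    refine h1.trans_isLittleO ?_
    simpa using ho.norm_left.mul_isBigO hb.norm_left

lemma piece_succ {n k : ℕ} {A C S : Set (Fin n → ℝ)} (hCA : C ⊆ A)
    (hC : ∀ (F : Type) [NormedAddCommGroup F] [NormedSpace ℝ F] (g : (Fin n → ℝ) → F),
      Good (k + 1) A g → ∀ x ∈ C, fderiv ℝ g x = 0)
    (hS : Piece k C S) : Piece (k + 1) A S := by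
  obtain ⟨m, hm, ψ, B, h1, h2, h3, h4⟩ := hS
  refine ⟨m, hm, ψ, B, h1, h2.mono_right hCA, h3, fun F _ _ g hg x hx => ?_⟩
  have hgA := hg (ψ x) (hCA (h2 hx))
  have := littleO_step (k := k) (hgA.1.of_le (by simp)) (h3 x hx)
    (h4 _ (fderiv ℝ g) (fun y hy =>
      ⟨(hg y (hCA hy)).1.fderiv_right (by simp), hC F g hg y hy⟩) x hx)
  simpa [hgA.2] using this

lemma fderiv_eq_zero_of_real {n k : ℕ} {A : Set (Fin n → ℝ)} {x : Fin n → ℝ} (hx : x ∈ A)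
    (h : ∀ g : (Fin n → ℝ) → ℝ, Good (k + 1) A g → fderiv ℝ g x = 0)
    (F : Type) [NormedAddCommGroup F] [NormedSpace ℝ F] (g : (Fin n → ℝ) → F)
    (hg : Good (k + 1) A g) : fderiv ℝ g x = 0 := by
  ext v
  by_contra hv
  obtain ⟨l, hl⟩ := SeparatingDual.exists_ne_zero (R := ℝ) hv
  refine hl ?_
  have h1 := h (fun y => l (g y)) fun y hy =>
    ⟨l.contDiff.contDiffAt.comp y (hg y hy).1, by simp [(hg y hy).2]⟩
  have h2 : HasFDerivAt (fun y => l (g y)) (l.comp (fderiv ℝ g x)) x :=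
    l.hasFDerivAt.comp x ((hg x hx).1.differentiableAt (by simp)).hasFDerivAt
  rw [h2.fderiv] at h1
  simpa using congrArg (fun M => M v) h1

lemma dec_near {n k : ℕ} (IH : ∀ A : Set (Fin n → ℝ), Dec (k + 1) A A)
    {A : Set (Fin (n + 1) → ℝ)} {x0 : Fin (n + 1) → ℝ} (hx0 : x0 ∈ A)
    {g : (Fin (n + 1) → ℝ) → ℝ} (hg : Good (k + 1) A g) (hg0 : fderiv ℝ g x0 ≠ 0) :
    ∃ V ∈ 𝓝 x0, Dec (k + 1) A (V ∩ A) := by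
  let G : (Fin (n + 1) → ℝ) → (Fin 1 → ℝ) := fun x _ => g x
  have hG : ContDiffAt ℝ (k + 1 : ℕ) G x0 := contDiffAt_pi.2 fun _ => (hg x0 hx0).1
  have hG' : HasFDerivAt G (ContinuousLinearMap.pi fun _ => fderiv ℝ g x0) x0 :=
    hasFDerivAt_pi.2 fun _ => ((hg x0 hx0).1.differentiableAt (by simp)).hasFDerivAt
  have hsurj : Function.Surjective (fderiv ℝ G x0) := by
    rw [hG'.fderiv]
    intro c
    obtain ⟨v, hv⟩ : ∃ v, fderiv ℝ g x0 v ≠ 0 := by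
      by_contra! hcon
      exact hg0 (ContinuousLinearMap.ext hcon)
    refine ⟨(c 0 / fderiv ℝ g x0 v) • v, ?_⟩
    ext i
    fin_cases i
    simp [hv]
  obtain ⟨V, hV, W, hWo, Ψ, φ, hW, hVW⟩ :=
    straighten (d := n) (by omega) (by omega) x0 G hG hsurj univ univ_mem
  refine ⟨V, hV, ?_⟩
  let ψ : (Fin n → ℝ) → (Fin (n + 1) → ℝ) := fun y => Ψ (0, y)
  let A' : Set (Fin n → ℝ) := {y | ((0 : Fin 1 → ℝ), y) ∈ W ∧ ψ y ∈ A}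
  have hψ : ∀ y ∈ A', ContDiffAt ℝ (k + 1 : ℕ) ψ y := fun y hy =>
    (hW _ hy.1).1.comp y (contDiffAt_const.prodMk contDiffAt_id)
  obtain ⟨T, hT, hTA, hTP⟩ := IH A'
  refine ⟨(fun S => ψ '' S) '' T, hT.image _, ?_, ?_⟩
  · rintro x ⟨hxV, hxA⟩
    obtain ⟨h1, h2⟩ := hVW x hxV
    have h0 : G x = 0 := by ext i; exact (hg x hxA).2
    rw [h0] at h1 h2
    have hmem : φ x ∈ A' := ⟨h1, by change Ψ (0, φ x) ∈ A; rwa [h2]⟩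
    obtain ⟨S, hS, hxS⟩ := hTA hmem
    exact ⟨_, mem_image_of_mem _ hS, φ x, hxS, h2⟩
  · rintro _ ⟨S, hS, rfl⟩
    obtain ⟨m, hm, ψ', B, h1, h2, h3, h4⟩ := hTP S hS
    refine ⟨m, by omega, ψ ∘ ψ', B, ?_, fun x hx => (h2 hx).2, fun x hx => ?_, ?_⟩
    · rw [image_comp]; exact image_mono h1
    · exact ((hψ _ (h2 hx)).of_le (by simp)).comp x (h3 x hx)
    · intro F _ _ u hu
      exact h4 F (fun y => u (ψ y)) fun y hy =>
        ⟨(hu _ hy.2).1.comp y (hψ y hy), (hu _ hy.2).2⟩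

lemma dec_step {n k : ℕ} (IHk : ∀ A : Set (Fin n → ℝ), Dec k A A) (A : Set (Fin n → ℝ))
    (H : ∀ x0 ∈ A, ∀ g : (Fin n → ℝ) → ℝ, Good (k + 1) A g → fderiv ℝ g x0 ≠ 0 →
      ∃ V ∈ 𝓝 x0, Dec (k + 1) A (V ∩ A)) : Dec (k + 1) A A := by
  let C : Set (Fin n → ℝ) :=
    {x ∈ A | ∀ g : (Fin n → ℝ) → ℝ, Good (k + 1) A g → fderiv ℝ g x = 0}
  have hCA : C ⊆ A := fun x hx => hx.1
  have hC : Dec (k + 1) A C := by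
    obtain ⟨T, h1, h2, h3⟩ := IHk C
    exact ⟨T, h1, h2, fun S hS => piece_succ hCA
      (fun F _ _ g hg x hx => fderiv_eq_zero_of_real hx.1 hx.2 F g hg) (h3 S hS)⟩
  have hD : Dec (k + 1) A (A \ C) := by
    have : ∀ x ∈ A \ C, ∃ V ∈ 𝓝 x, Dec (k + 1) A (V ∩ A) := by
      rintro x ⟨hxA, hxC⟩
      have : ¬ ∀ g : (Fin n → ℝ) → ℝ, Good (k + 1) A g → fderiv ℝ g x = 0 :=
        fun h => hxC ⟨hxA, h⟩
      push Not at this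
      obtain ⟨g, hg, hg0⟩ := this
      exact H x hxA g hg hg0
    choose! V hV hVD using this
    obtain ⟨t, htD, htc, ht⟩ := TopologicalSpace.countable_cover_nhdsWithin (s := A \ C) (f := V)
      fun x hx => mem_nhdsWithin_of_mem_nhds (hV x hx)
    refine Dec.biUnion htc (fun i => V i ∩ A) ?_ fun i hi => hVD i (htD hi)
    intro x hx
    obtain ⟨i, hi, hxi⟩ := mem_iUnion₂.1 (ht hx)
    exact mem_iUnion₂.2 ⟨i, hi, hxi, hx.1⟩
  have := hC.union hD
  rwa [union_sdiff_cancel hCA] at this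

lemma dec_zero {n : ℕ} (A : Set (Fin n → ℝ)) : Dec 0 A A := by
  refine ⟨{A}, countable_singleton _, by simp, ?_⟩
  rintro S rfl
  refine ⟨n, le_rfl, id, S, by simp, mapsTo_id _, fun x _ => contDiffAt_id, ?_⟩
  intro F _ _ g hg x hx
  have := (hg x hx).1.continuousAt
  simp only [pow_zero, id, isLittleO_one_iff]
  rw [ContinuousAt, (hg x hx).2] at this
  exact this

/-- A. P. Morse's decomposition lemma. -/
lemma dec_all (n k : ℕ) : ∀ A : Set (Fin n → ℝ), Dec k A A := by
  induction n generalizing k with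
  | zero =>
    induction k with
    | zero => exact dec_zero
    | succ k ih =>
      refine fun A => dec_step ih A fun x0 _ g _ hg => absurd ?_ hg
      ext v
      rw [Subsingleton.elim v 0, map_zero, map_zero]
  | succ n IH =>
    induction k with
    | zero => exact dec_zero
    | succ k ih =>
      exact fun A => dec_step ih A fun x0 hx0 g hg hg0 => dec_near (IH (k + 1)) hx0 hg hg0

/-- The image of points with vanishing derivative. -/
lemma null_of_fderiv_zero {n m s : ℕ} (hs : 1 ≤ s) (hm : 1 ≤ m) (hnm : n ≤ s * m)
    (h : (Fin n → ℝ) → (Fin m → ℝ)) (A : Set (Fin n → ℝ))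
    (hA : ∀ x ∈ A, ContDiffAt ℝ s h x ∧ fderiv ℝ h x = 0) : volume (h '' A) = 0 := by
  obtain ⟨k, rfl⟩ : ∃ k, s = k + 1 := ⟨s - 1, by omega⟩
  obtain ⟨T, hT, hTA, hTP⟩ := dec_all n k A
  have : h '' A ⊆ ⋃ S ∈ T, h '' S := by
    rintro _ ⟨x, hx, rfl⟩
    obtain ⟨S, hS, hxS⟩ := hTA hx
    exact mem_biUnion hS (mem_image_of_mem h hxS)
  refine measure_mono_null this ((measure_biUnion_null_iff hT).2 fun S hS => ?_)
  obtain ⟨d, hd, ψ, B, h1, h2, h3, h4⟩ := hTP S hS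
  refine measure_mono_null (t := (h ∘ ψ) '' B) (by rw [image_comp]; exact image_mono h1) ?_
  refine null_image (s := k + 1) hs hm (by omega) _ B fun x hx => ?_
  exact littleO_step (ψ := ψ) ((hA _ (h2 hx)).1.of_le (by simp)) (h3 x hx)
    (h4 _ (fderiv ℝ h) (fun y hy => ⟨(hA y hy).1.fderiv_right (by simp), (hA y hy).2⟩) x hx)

lemma split_target {q r c : ℕ} (hq : q = r + c) (R : Submodule ℝ (Fin q → ℝ))
    (hR : Module.finrank ℝ R = r) :
    ∃ e : (Fin q → ℝ) ≃L[ℝ] (Fin r → ℝ) × (Fin c → ℝ),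
      (∀ y ∈ R, (e y).2 = 0) ∧ ∀ a, ∃ y ∈ R, (e y).1 = a := by
  obtain ⟨C, hC⟩ := R.exists_isCompl
  have hCf : Module.finrank ℝ C = c := by
    have := Submodule.finrank_add_eq_of_isCompl hC
    simp only [Module.finrank_fin_fun] at this
    omega
  let eR : R ≃ₗ[ℝ] (Fin r → ℝ) := LinearEquiv.ofFinrankEq _ _ (by simp [hR])
  let eC : C ≃ₗ[ℝ] (Fin c → ℝ) := LinearEquiv.ofFinrankEq _ _ (by simp [hCf])
  let e := (R.prodEquivOfIsCompl C hC).symm.trans (eR.prodCongr eC)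
  have he : ∀ y : R, e y = (eR y, 0) := by
    intro y
    simp [e]
  refine ⟨e.toContinuousLinearEquiv, fun y hy => ?_, fun a => ⟨eR.symm a, (eR.symm a).2, ?_⟩⟩
  · exact congrArg Prod.snd (he ⟨y, hy⟩)
  · exact (congrArg Prod.fst (he (eR.symm a))).trans (by simp)

/-- If `(fst, G)` has rank at most `r`, then `G` vanishes on the second factor. -/
lemma comp_inr_eq_zero {r d c : ℕ} (G : (Fin r → ℝ) × (Fin d → ℝ) →L[ℝ] (Fin c → ℝ))
    (R : Submodule ℝ ((Fin r → ℝ) × (Fin c → ℝ))) (hR : Module.finrank ℝ R ≤ r)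
    (h : ∀ v, (v.1, G v) ∈ R) : G.comp (ContinuousLinearMap.inr ℝ _ _) = 0 := by
  let L : R →ₗ[ℝ] (Fin r → ℝ) := (LinearMap.fst ℝ (Fin r → ℝ) (Fin c → ℝ)).domRestrict R
  have hLs : Function.Surjective L := fun a => ⟨⟨_, h (a, 0)⟩, rfl⟩
  have hfr : Module.finrank ℝ R = Module.finrank ℝ (Fin r → ℝ) := by
    have := LinearMap.finrank_le_finrank_of_surjective hLs
    simp only [Module.finrank_fin_fun] at this ⊢
    omega
  have hLi : Function.Injective L :=
    (LinearMap.injective_iff_surjective_of_finrank_eq_finrank hfr).2 hLs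
  refine ContinuousLinearMap.ext fun b => ?_
  have h1 : (⟨_, h (0, b)⟩ : R) = ⟨0, R.zero_mem⟩ := hLi rfl
  have h2 := congrArg (fun z : R => z.1.2) h1
  simpa using h2

lemma measurable_image {r d : ℕ} (W : Set ((Fin r → ℝ) × (Fin d → ℝ))) (hW : IsOpen W)
    {X Y : Type*} [TopologicalSpace X] [T1Space X] [TopologicalSpace Y] [T2Space Y]
    [MeasurableSpace Y] [BorelSpace Y] (x0 : X)
    (u : (Fin r → ℝ) × (Fin d → ℝ) → X) (hu : ContinuousOn u W)
    (h : (Fin r → ℝ) × (Fin d → ℝ) → Y) (hh : ContinuousOn h W) :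
    MeasurableSet (h '' {w ∈ W | u w = x0}) := by
  obtain ⟨F, hFc, hFW, hFU, -⟩ := hW.exists_iUnion_isClosed
  have hZ : {w ∈ W | u w = x0} =
      ⋃ (i : ℕ) (j : ℕ), (F i ∩ u ⁻¹' {x0}) ∩ Metric.closedBall 0 j := by
    rw [← hFU]
    ext w
    simp only [mem_ofPred_eq, mem_iUnion, mem_inter_iff, mem_preimage, mem_singleton_iff]
    constructor
    · rintro ⟨⟨i, hi⟩, hw⟩
      obtain ⟨j, hj⟩ := exists_nat_ge (dist w 0)
      exact ⟨i, j, ⟨hi, hw⟩, hj⟩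
    · rintro ⟨i, j, ⟨hi, hw⟩, hj⟩
      exact ⟨⟨i, hi⟩, hw⟩
  rw [hZ]
  simp only [image_iUnion]
  refine MeasurableSet.iUnion fun i => MeasurableSet.iUnion fun j => ?_
  have hcl : IsClosed (F i ∩ u ⁻¹' {x0}) :=
    (hu.mono (hFW i)).preimage_isClosed_of_isClosed (hFc i) isClosed_singleton
  have hcomp : IsCompact ((F i ∩ u ⁻¹' {x0}) ∩ Metric.closedBall 0 (j : ℝ)) :=
    (isCompact_closedBall _ _).inter_left hcl
  exact (hcomp.image_of_continuousOn
    (hh.mono fun w hw => hFW i hw.1.1)).isClosed.measurableSet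

lemma local_null {p q s r : ℕ} (hs : max ((p : ℤ) - (q : ℤ)) 0 < (s : ℤ)) (hr : r < q)
    (U : Set (Fin p → ℝ)) (hU : IsOpen U)
    (f : (Fin p → ℝ) → (Fin q → ℝ)) (hf : ∀ x ∈ U, ContDiffAt ℝ s f x)
    (x0 : Fin p → ℝ) (hx0 : x0 ∈ U)
    (hr0 : Module.finrank ℝ (LinearMap.range (fderiv ℝ f x0 : (Fin p → ℝ) →ₗ[ℝ] (Fin q → ℝ))) = r) :
    ∃ V ∈ 𝓝 x0, volume (f '' {x ∈ V | x ∈ U ∧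
      Module.finrank ℝ (LinearMap.range (fderiv ℝ f x : (Fin p → ℝ) →ₗ[ℝ] (Fin q → ℝ))) = r}) = 0 := by
  have hs1 : 1 ≤ s := by omega
  have hs0 : (s : WithTop ℕ∞) ≠ 0 := by exact_mod_cast (by omega : s ≠ 0)
  obtain ⟨c, hc⟩ : ∃ c, q = r + c := ⟨q - r, by omega⟩
  obtain ⟨d, hd⟩ : ∃ d, p = r + d := by
    have := LinearMap.finrank_range_le (fderiv ℝ f x0 : (Fin p → ℝ) →ₗ[ℝ] (Fin q → ℝ))
    rw [hr0, Module.finrank_fin_fun] at this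
    exact ⟨p - r, by omega⟩
  have hdc : d ≤ s * c := by
    rcases le_total d c with h | h
    · nlinarith
    · obtain ⟨t, rfl⟩ := Nat.exists_eq_add_of_le h
      have h1 : t + 1 ≤ s := by omega
      have h2 : 1 ≤ c := by omega
      nlinarith
  obtain ⟨e, he2, he1⟩ := split_target hc _ hr0
  let F : (Fin p → ℝ) → (Fin r → ℝ) := fun x => (e (f x)).1
  let A1 : (Fin q → ℝ) →L[ℝ] (Fin r → ℝ) :=
    (ContinuousLinearMap.fst ℝ (Fin r → ℝ) (Fin c → ℝ)).comp (e : _ →L[ℝ] _)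
  have hF : ContDiffAt ℝ s F x0 := A1.contDiff.contDiffAt.comp x0 (hf x0 hx0)
  have hF' : HasFDerivAt F (A1.comp (fderiv ℝ f x0)) x0 :=
    A1.hasFDerivAt.comp x0 ((hf x0 hx0).differentiableAt hs0).hasFDerivAt
  have hsurj : Function.Surjective (fderiv ℝ F x0) := by
    rw [hF'.fderiv]
    intro a
    obtain ⟨y, ⟨v, rfl⟩, hy⟩ := he1 a
    exact ⟨v, hy⟩
  obtain ⟨V, hV, W, hWo, Ψ, φ, hW, hVW⟩ :=
    straighten hs1 hd x0 F hF hsurj U (hU.mem_nhds hx0)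
  refine ⟨V, hV, ?_⟩
  let H : (Fin r → ℝ) × (Fin d → ℝ) → (Fin r → ℝ) × (Fin c → ℝ) := fun w => e (f (Ψ w))
  let g : (Fin r → ℝ) × (Fin d → ℝ) → (Fin c → ℝ) := fun w => (H w).2
  have hH : ∀ w ∈ W, ContDiffAt ℝ s H w := fun w hw =>
    e.contDiff.contDiffAt.comp w ((hf _ (hW w hw).2.1).comp w (hW w hw).1)
  have hg : ∀ w ∈ W, ContDiffAt ℝ s g w := fun w hw => (hH w hw).snd
  have hHg : ∀ w ∈ W, H w = (w.1, g w) := fun w hw => Prod.ext (hW w hw).2.2 rfl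
  let u := fun w => (fderiv ℝ g w).comp (ContinuousLinearMap.inr ℝ (Fin r → ℝ) (Fin d → ℝ))
  have hu : ContinuousOn u W := by
    intro w hw
    have : ContinuousAt (fderiv ℝ g) w :=
      ((hg w hw).fderiv_right (m := 0) (by exact_mod_cast hs1)).continuousAt
    exact (this.clm_comp continuousAt_const).continuousWithinAt
  have hHc : ContinuousOn H W := fun w hw => (hH w hw).continuousAt.continuousWithinAt
  let Z := {w ∈ W | u w = 0}
  have hMm : MeasurableSet (H '' Z) := measurable_image W hWo 0 u hu H hHc
  have hM0 : volume (H '' Z) = 0 := by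
    refine Measure.measure_prod_null_of_ae_null hMm (Filter.Eventually.of_forall fun a => ?_)
    refine measure_mono_null (t := (fun b => g (a, b)) '' {b | (a, b) ∈ Z}) ?_ ?_
    · rintro y ⟨w, hw, hwy⟩
      rw [hHg w hw.1, Prod.mk.injEq] at hwy
      obtain ⟨rfl, rfl⟩ := hwy
      exact ⟨w.2, hw, rfl⟩
    · refine null_of_fderiv_zero hs1 (by omega) hdc _ _ fun b hb => ⟨?_, ?_⟩
      · exact (hg _ hb.1).comp b (contDiffAt_const.prodMk contDiffAt_id)
      · have h1 : HasFDerivAt (fun b => g (a, b)) (u (a, b)) b :=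
          ((hg _ hb.1).differentiableAt hs0).hasFDerivAt.comp b (hasFDerivAt_prodMk_right a b)
        rw [h1.fderiv]
        exact hb.2
  have hpre : volume (e ⁻¹' (H '' Z)) = 0 := by
    rw [← Measure.map_apply e.continuous.measurable hMm]
    have : (volume : Measure ((Fin r → ℝ) × (Fin c → ℝ))).IsAddHaarMeasure := by
      rw [Measure.volume_eq_prod]
      exact Measure.prod.instIsAddHaarMeasure _ _
    have : (Measure.map e volume : Measure ((Fin r → ℝ) × (Fin c → ℝ))) ≪ volume :=
      Measure.absolutelyContinuous_isAddHaarMeasure _ _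
    exact this hM0
  refine measure_mono_null ?_ hpre
  rintro _ ⟨x, ⟨hxV, hxU, hxr⟩, rfl⟩
  obtain ⟨hw, hwx⟩ := hVW x hxV
  set w := (F x, φ x) with hwdef
  refine ⟨w, ⟨hw, ?_⟩, by simp only [H, hwx]⟩
  have h1 : HasFDerivAt H ((e : _ →L[ℝ] _).comp ((fderiv ℝ f x).comp (fderiv ℝ Ψ w))) w := by
    have hfx : HasFDerivAt f (fderiv ℝ f x) (Ψ w) := by
      rw [hwx]; exact ((hf x hxU).differentiableAt hs0).hasFDerivAt
    exact e.hasFDerivAt.comp w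
      (hfx.comp w ((hW w hw).1.differentiableAt hs0).hasFDerivAt)
  have h2 : HasFDerivAt H ((ContinuousLinearMap.fst ℝ _ _).prod (fderiv ℝ g w)) w := by
    have h3 : HasFDerivAt (fun w : (Fin r → ℝ) × (Fin d → ℝ) => (w.1, g w))
        ((ContinuousLinearMap.fst ℝ _ _).prod (fderiv ℝ g w)) w :=
      hasFDerivAt_fst.prodMk ((hg w hw).differentiableAt hs0).hasFDerivAt
    refine h3.congr_of_eventuallyEq ?_
    filter_upwards [hWo.mem_nhds hw] with z hz using hHg z hz
  have h3 := h1.unique h2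
  refine comp_inr_eq_zero (fderiv ℝ g w)
    ((LinearMap.range (fderiv ℝ f x : (Fin p → ℝ) →ₗ[ℝ] (Fin q → ℝ))).map
      (e : (Fin q → ℝ) →ₗ[ℝ] (Fin r → ℝ) × (Fin c → ℝ))) ?_ ?_
  · exact (Submodule.finrank_map_le _ _).trans hxr.le
  · intro v
    have h4 := congrArg (fun M => M v) h3
    exact ⟨fderiv ℝ f x (fderiv ℝ Ψ w v), ⟨_, rfl⟩, h4⟩

end SardAux

/-- **Sard's theorem.** If `f : U ⊆ ℝ^p → ℝ^q` is of class `C^s` with `s > max (p - q) 0`,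
then the set of critical values of `f` has Lebesgue measure zero in `ℝ^q`. -/
theorem sard_critical_values_measure_zero (p q s : ℕ)
    (hs : max ((p : ℤ) - (q : ℤ)) 0 < (s : ℤ))
    (U : Set (Fin p → ℝ)) (hU : IsOpen U)
    (f : (Fin p → ℝ) → (Fin q → ℝ)) (hf : ContDiffOn ℝ s f U) :
    volume {y : Fin q → ℝ |
      ∃ x ∈ U, f x = y ∧ ¬ Function.Surjective (fderiv ℝ f x)} = 0 := by
  have hf' : ∀ x ∈ U, ContDiffAt ℝ s f x := fun x hx => hf.contDiffAt (hU.mem_nhds hx)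
  let rk : (Fin p → ℝ) → ℕ := fun x =>
    Module.finrank ℝ (LinearMap.range (fderiv ℝ f x : (Fin p → ℝ) →ₗ[ℝ] (Fin q → ℝ)))
  have hrk : ∀ r < q, volume (f '' {x ∈ U | rk x = r}) = 0 := by
    intro r hr
    have : ∀ x ∈ {x ∈ U | rk x = r}, ∃ V ∈ 𝓝 x,
        volume (f '' {x ∈ V | x ∈ U ∧ rk x = r}) = 0 := fun x hx =>
      SardAux.local_null hs hr U hU f hf' x hx.1 hx.2
    choose! V hV hV0 using this
    obtain ⟨t, htD, htc, ht⟩ := TopologicalSpace.countable_cover_nhdsWithin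
      (s := {x ∈ U | rk x = r}) (f := V) fun x hx => mem_nhdsWithin_of_mem_nhds (hV x hx)
    refine measure_mono_null ?_ ((measure_biUnion_null_iff htc).2 fun i hi => hV0 i (htD hi))
    rintro _ ⟨x, hx, rfl⟩
    obtain ⟨i, hi, hxi⟩ := mem_iUnion₂.1 (ht hx)
    exact mem_biUnion hi ⟨x, ⟨hxi, hx⟩, rfl⟩
  refine measure_mono_null (t := ⋃ r ∈ Set.Iio q, f '' {x ∈ U | rk x = r}) ?_
    ((measure_biUnion_null_iff (Set.to_countable _)).2 hrk)
  rintro _ ⟨x, hx, rfl, hns⟩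
  refine mem_biUnion (x := rk x) ?_ ⟨x, ⟨hx, rfl⟩, rfl⟩
  have hne : LinearMap.range (fderiv ℝ f x : (Fin p → ℝ) →ₗ[ℝ] (Fin q → ℝ)) ≠ ⊤ :=
    fun h => hns (LinearMap.range_eq_top.1 h)
  have := Submodule.finrank_lt hne
  simpa [rk] using this
end

section
/- Let d ≥ 2. The set of continuous functions f ∈ C([0,1], ℝ^d) such that the interior of the image f([0,1]) is empty is generic (residual) in C([0,1], ℝ^d) endowed with the uniform (sup-norm) topology, i.e. it contains a countable intersection of dense open subsets. -/
open Set Topology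

lemma dense_avoid (d : ℕ) (hd : 2 ≤ d) (q : Fin d → ℝ) :
    Dense {f : C(unitInterval, Fin d → ℝ) | MapsTo f univ {q}ᶜ} := by
  rw [Metric.dense_iff]
  intro f r hr
  have hp : ∀ i : Fin d, ∃ p : Polynomial ℝ, ‖p.toContinuousMapOn (Set.Icc 0 1) -
      (⟨fun t => f t i, by fun_prop⟩ : C(Set.Icc (0:ℝ) 1, ℝ))‖ < r / 3 := fun i =>
    exists_polynomial_near_continuousMap 0 1 _ _ (by positivity)
  choose p hp using hp
  have hg : ContDiff ℝ 1 (fun (t : ℝ) (i : Fin d) => (p i).eval t) := by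
    rw [contDiff_pi]
    intro i
    simpa [Polynomial.coe_aeval_eq_eval] using (p i).contDiff_aeval (𝕜 := ℝ) 1
  have hD := hg.dense_compl_range_of_finrank_lt_finrank (by simp; omega)
  obtain ⟨q', hq', hqd⟩ := hD.exists_dist_lt q (show 0 < r / 3 by positivity)
  refine ⟨⟨fun t => (fun i => (p i).eval (t : ℝ)) + (q - q'), by fun_prop⟩, ?_, ?_⟩
  · rw [Metric.mem_ball]
    refine lt_of_le_of_lt ((ContinuousMap.dist_le (C := r / 3 + r / 3) (by positivity)).2 ?_) (by linarith)
    intro t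
    have h1 : dist (fun i => (p i).eval (t : ℝ)) (f t) ≤ r / 3 := by
      rw [dist_pi_le_iff (by positivity)]
      intro i
      have := (ContinuousMap.norm_coe_le_norm _ t).trans (hp i).le
      simpa [dist_eq_norm] using this
    rw [dist_eq_norm] at h1 hqd ⊢
    have : (fun i => (p i).eval (t : ℝ)) + (q - q') - f t =
      ((fun i => (p i).eval (t : ℝ)) - f t) + (q - q') := by abel
    change ‖(fun i => (p i).eval (t : ℝ)) + (q - q') - f t‖ ≤ _
    rw [this]
    exact (norm_add_le _ _).trans (by linarith)
  · intro t _ h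
    apply hq'
    refine ⟨t, ?_⟩
    have h : (fun i => (p i).eval (t : ℝ)) + (q - q') = q := h
    have h2 := congrArg (fun z => z - (q - q')) h
    simpa using h2

/-- For `d ≥ 2`, the set of continuous functions `f : [0,1] → ℝ^d` whose image has empty
interior is residual (generic) in `C([0,1], ℝ^d)` with the uniform topology. -/
theorem generic_empty_interior_image (d : ℕ) (hd : 2 ≤ d) :
    {f : C(unitInterval, Fin d → ℝ) | interior (Set.range f) = ∅} ∈
      residual C(unitInterval, Fin d → ℝ) := by
  have h : ∀ n : ℕ, {f : C(unitInterval, Fin d → ℝ) |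
      MapsTo f univ {TopologicalSpace.denseSeq (Fin d → ℝ) n}ᶜ} ∈
      residual C(unitInterval, Fin d → ℝ) := fun n =>
    residual_of_dense_open
      (ContinuousMap.isOpen_setOfPred_mapsTo isCompact_univ isOpen_compl_singleton)
      (dense_avoid d hd _)
  filter_upwards [countable_iInter_mem.2 h] with f hf
  rw [mem_iInter] at hf
  by_contra hne
  obtain ⟨x, hx, n, rfl⟩ := (TopologicalSpace.denseRange_denseSeq (Fin d → ℝ)).exists_mem_open
    isOpen_interior (nonempty_iff_ne_empty.2 hne) |>.elim
      (fun n hn => (⟨_, hn, n, rfl⟩ : ∃ x ∈ interior (range f), ∃ n,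
        TopologicalSpace.denseSeq (Fin d → ℝ) n = x))
  obtain ⟨t, ht⟩ := interior_subset hx
  exact hf n (mem_univ t) ht
end
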